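/- For every A ∈ yℌ and B ∈ ℌx, there exist real sequences (a_n)_{n≥1} and (b_n)_{n≥1} such that the Dirichlet series L1(s) = ∑_{n≥1} a_n/n^s and L2(s) = ∑_{n≥1} b_n/n^s converge for all integers s ≥ 0, and Z(A(x+y)^s B) = L1(s) + s·L2(s) holds for all integers s ≥ 0. -/

import Mathlib

open scoped BigOperators

noncomputable section

/-- `ℌ = ℚ⟨x,y⟩`, the free noncommutative polynomial ring in two indeterminates,
realized as the free `ℚ`-algebra on `Bool` (`false ↦ x`, `true ↦ y`). -/
abbrev H : Type := FreeAlgebra ℚ Bool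

/-- The indeterminate `x`. -/
def Hx : H := FreeAlgebra.ι ℚ false

/-- The indeterminate `y`. -/
def Hy : H := FreeAlgebra.ι ℚ true

/-- The multiple zeta value `ζ(k₁,…,k_r) = ∑_{0<n₁<⋯<n_r} 1/(n₁^{k₁}⋯n_r^{k_r})`. -/
def MZV (r : ℕ) (k : Fin r → ℕ) : ℝ :=
  ∑' n : {n : Fin r → ℕ // (∀ i, 0 < n i) ∧ StrictMono n},
    ∏ i, (1 : ℝ) / (n.1 i : ℝ) ^ (k i)

/-- `Z : yℌx → ℝ` is the `ℚ`-linear map with `Z(y x^{k₁-1} ⋯ y x^{k_r-1}) = ζ(k₁,…,k_r)`.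
We encode it as a `ℚ`-linear map on all of `ℌ` whose values on the basis monomials
`y x^{k₁-1} ⋯ y x^{k_r-1}` (with `k_r ≥ 2`) of `yℌx` are the multiple zeta values;
these values determine `Z` uniquely on the subspace `yℌx`. -/
def IsZetaMap (Z : H →ₗ[ℚ] ℝ) : Prop :=
  ∀ (r : ℕ) (k : Fin (r + 1) → ℕ), (∀ i, 1 ≤ k i) → 2 ≤ k (Fin.last r) →
    Z ((List.ofFn fun i => Hy * Hx ^ (k i - 1)).prod) = MZV (r + 1) k

/-- The family `f(A,B) = (Z(A(x+y)^s B))_{s ≥ 0}`. -/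
def fam (Z : H →ₗ[ℚ] ℝ) (A B : H) : ℕ → ℝ := fun s => Z (A * (Hx + Hy) ^ s * B)

/-- The `ℚ`-bilinear product `◇` on `ℌ`, characterized by its recursive defining
properties (which determine it uniquely). -/
def IsDiamond (d : H →ₗ[ℚ] H →ₗ[ℚ] H) : Prop :=
  (∀ w, d w 1 = w) ∧ (∀ w, d 1 w = w) ∧
  (∀ w1 w2, d (Hx * w1) (Hx * w2) = Hx * d w1 (Hx * w2) - Hx * d (Hy * w1) w2) ∧
  (∀ w1 w2, d (Hx * w1) (Hy * w2) = Hx * d w1 (Hy * w2) + Hy * d (Hx * w1) w2) ∧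
  (∀ w1 w2, d (Hy * w1) (Hx * w2) = Hy * d w1 (Hx * w2) + Hx * d (Hy * w1) w2) ∧
  (∀ w1 w2, d (Hy * w1) (Hy * w2) = Hy * d w1 (Hy * w2) - Hy * d (Hx * w1) w2)

/-- The harmonic product `∗` on `ℌ`, characterized by its recursive defining
properties (which determine it uniquely). -/
def IsHarmonic (st : H →ₗ[ℚ] H →ₗ[ℚ] H) : Prop :=
  (∀ w, st w 1 = w) ∧ (∀ w, st 1 w = w) ∧
  (∀ w1 w2, st (Hx * w1) w2 = Hx * st w1 w2) ∧
  (∀ w1 w2, st w1 (Hx * w2) = Hx * st w1 w2) ∧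
  (∀ w1 w2, st (Hy * w1) (Hy * w2) = Hy * (st w1 (Hy * w2) + st (Hy * w1) w2 + Hx * st w1 w2))

/-- The anti-automorphism `τ` of `ℌ` interchanging `x` and `y`, characterized by
being `ℚ`-linear, anti-multiplicative, unital, and swapping the generators. -/
def IsTau (t : H →ₗ[ℚ] H) : Prop :=
  t 1 = 1 ∧ (∀ a b, t (a * b) = t b * t a) ∧ t Hx = Hy ∧ t Hy = Hx

/-- The automorphism `φ` of `ℌ` with `φ(x) = x + y` and `φ(y) = -y`. -/
def phi : H →ₐ[ℚ] H := FreeAlgebra.lift ℚ (fun b => if b then -Hy else Hx + Hy)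

/-- The automorphism `S₁` of `ℌ` with `S₁(x) = x` and `S₁(y) = x + y`. -/
def S1 : H →ₐ[ℚ] H := FreeAlgebra.lift ℚ (fun b => if b then Hx + Hy else Hx)

/-- The Dirichlet series `∑_{n ≥ 1} a_n / n^s` (with `a n` the coefficient indexed by
`n + 1`) converges to `L` at `s`, i.e. its partial sums tend to `L`. -/
def DSConv (a : ℕ → ℝ) (s : ℕ) (L : ℝ) : Prop :=
  Filter.Tendsto (fun N => ∑ n ∈ Finset.range N, a n / ((n : ℝ) + 1) ^ s)
    Filter.atTop (nhds L)


section Helpers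

open Set Filter Topology MeasureTheory

theorem ftc_Ioi {g g' : ℝ → ℝ} {m : ℝ} (p : ℝ) (h : ∀ x, HasDerivAt g (g' x) x) (h0 : ∀ x, 0 ≤ g' x)
    (hm : Tendsto g atTop (𝓝 m)) : ∫⁻ q in Ioi p, ENNReal.ofReal (g' q) = ENNReal.ofReal (m - g p) := by
  have hi := integrableOn_Ioi_deriv_of_nonneg' (a := p) (fun x _ => h x) (fun x _ => h0 x) hm
  rw [← ofReal_integral_eq_lintegral_ofReal hi (Eventually.of_forall h0),
    integral_Ioi_of_hasDerivAt_of_tendsto' (fun x _ => h x) hi hm]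

theorem ftc_Iio {g g' : ℝ → ℝ} {m : ℝ} (p : ℝ) (h : ∀ x, HasDerivAt g (g' x) x) (h0 : ∀ x, 0 ≤ g' x)
    (hm : Tendsto g atBot (𝓝 m)) : ∫⁻ q in Iio p, ENNReal.ofReal (g' q) = ENNReal.ofReal (g p - m) := by
  have hi : IntegrableOn g' (Iic p) := by
    have := integrableOn_Ioi_deriv_of_nonneg' (a := -p) (g := fun x => - g (-x)) (g' := fun x => g' (-x))
      (l := -m)
      (fun x _ => HasDerivAt.congr_deriv (((h (-x)).comp x (hasDerivAt_neg x)).neg) (by simp)) (fun x _ => h0 _)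
      (hm.comp tendsto_neg_atTop_atBot).neg
    rw [integrableOn_Iic_iff_integrableOn_Iio]
    have := this.comp_neg_Iio
    simpa using this
  rw [setLIntegral_congr Iio_ae_eq_Iic, ← ofReal_integral_eq_lintegral_ofReal hi (Eventually.of_forall h0),
    integral_Iic_of_hasDerivAt_of_tendsto' (fun x _ => h x) hi hm]

theorem ftc_univ {g g' : ℝ → ℝ} {m M : ℝ} (h : ∀ x, HasDerivAt g (g' x) x) (h0 : ∀ x, 0 ≤ g' x)
    (hm : Tendsto g atBot (𝓝 m)) (hM : Tendsto g atTop (𝓝 M)) :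
    ∫⁻ q, ENNReal.ofReal (g' q) = ENNReal.ofReal (M - m) := by
  have mono : Monotone g := monotone_of_hasDerivAt_nonneg h h0
  rw [← lintegral_add_compl _ (measurableSet_Ioi (a := (0:ℝ))), compl_Ioi,
    ← setLIntegral_congr Iio_ae_eq_Iic, ftc_Ioi 0 h h0 hM, ftc_Iio 0 h h0 hm,
    ← ENNReal.ofReal_add (sub_nonneg.2 (mono.ge_of_tendsto hM 0)) (sub_nonneg.2 (mono.le_of_tendsto hm 0))]
  congr 1; ring

/-- series term -/
noncomputable def tm (α β : ℕ → ℝ) (l : ℝ) (n : ℕ) : ℝ := Real.exp (-(n * l)) * (α n + β n * l)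

theorem tm_int {n : ℕ} (hn : n ≠ 0) (a b L : ℝ) :
    IntegrableOn (fun l => Real.exp (-(n * l)) * (a + b * l)) (Ioi L) ∧
    ∫ l in Ioi L, Real.exp (-(n * l)) * (a + b * l)
      = Real.exp (-(n * L)) * (a / n + b / n ^ 2 + b / n * L) := by
  have hn' : (0:ℝ) < n := by positivity
  have hd0 : ∀ a b x : ℝ, HasDerivAt (fun l : ℝ => -(Real.exp (-(n * l)) * (a / n + b / n ^ 2 + b / n * l)))
      (Real.exp (-(n * x)) * (a + b * x)) x := by
    intro a b x
    have h1 : HasDerivAt (fun l : ℝ => Real.exp (-(n * l))) (Real.exp (-(n * x)) * (-(n * 1))) x :=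
      (((hasDerivAt_id x).const_mul (n:ℝ)).neg).exp
    have h2 : HasDerivAt (fun l : ℝ => a / n + b / n ^ 2 + b / n * l) (b / n * 1) x :=
      ((hasDerivAt_id x).const_mul (b / n)).const_add _
    refine HasDerivAt.congr_deriv ((h1.mul h2).neg) ?_
    field_simp; ring
  have hd := hd0 a b
  have ht : ∀ c d : ℝ, Tendsto (fun l : ℝ => Real.exp (-(n * l)) * (c + d * l)) atTop (𝓝 0) := by
    intro c d
    have h1 : Tendsto (fun l : ℝ => (n:ℝ) * l) atTop atTop := tendsto_id.const_mul_atTop hn'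
    have h2 : Tendsto (fun l : ℝ => Real.exp (-(n * l))) atTop (𝓝 0) :=
      Real.tendsto_exp_neg_atTop_nhds_zero.comp h1
    have h3 := (Real.tendsto_pow_mul_exp_neg_atTop_nhds_zero 1).comp h1
    have := (h2.const_mul c).add (h3.const_mul (d / n))
    simp only [mul_zero, add_zero] at this
    refine this.congr fun l => ?_
    simp only [Function.comp, pow_one]; field_simp
  have hp : ∀ c : ℝ, IntegrableOn (fun l => Real.exp (-(n * l)) * c) (Ioi L) := by
    intro c
    have := (integrableOn_exp_mul_Ioi (a := -(n:ℝ)) (by linarith) L).mul_const c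
    simp only [neg_mul] at this
    exact this
  have hq : IntegrableOn (fun l => Real.exp (-(n * l)) * l) (Ioi L) := by
    -- shift so that the integrand is nonnegative
    have h1 : IntegrableOn (fun l => Real.exp (-(n * l)) * (-L + 1 * l)) (Ioi L) := by
      have hd2 := hd0 (-L) 1
      refine integrableOn_Ioi_deriv_of_nonneg' (fun x _ => hd2 x) (fun x hx => ?_)
        (ht ((-L) / n + 1 / n ^ 2) (1 / n)).neg
      have : L < x := hx
      exact mul_nonneg (Real.exp_pos _).le (by linarith)
    have := h1.add (hp L)
    refine this.congr_fun (fun l _ => ?_) measurableSet_Ioi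
    simp only [Pi.add_apply]; ring
  have hi : IntegrableOn (fun l => Real.exp (-(n * l)) * (a + b * l)) (Ioi L) := by
    refine ((hp a).add (hq.mul_const b)).congr_fun (fun l _ => ?_) measurableSet_Ioi
    simp only [Pi.add_apply]; ring
  refine ⟨hi, ?_⟩
  rw [integral_Ioi_of_hasDerivAt_of_tendsto' (fun x _ => hd x) hi
    (by simpa using (ht (a / n + b / n ^ 2) (b / n)).neg)]
  ring

theorem summ32 : Summable (fun n : ℕ => 1 / ((n:ℝ) * √n)) := by
  have := Real.summable_one_div_nat_rpow.2 (show (1:ℝ) < 3/2 by norm_num)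
  refine this.congr fun n => ?_
  rcases Nat.eq_zero_or_pos n with rfl | hn
  · simp
  have hn' : (0:ℝ) < n := by positivity
  rw [show (3/2:ℝ) = 1 + 1/2 by norm_num, Real.rpow_add hn', Real.rpow_one, Real.sqrt_eq_rpow]

theorem int_core {α β : ℕ → ℝ} {C : ℝ} (hα : ∀ n, |α n| ≤ C / √n) (hβ : ∀ n, |β n| ≤ C * √n)
    {f : ℝ → ENNReal} (hf : Measurable f)
    (h : ∀ l, 0 < l → f l ≠ ⊤ ∧ HasSum (tm α β l) (f l).toReal) {L : ℝ} (hL : 0 ≤ L) :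
    (∫⁻ l in Ioi L, f l) ≠ ⊤ ∧
    HasSum (tm (fun n => α n / n + β n / n ^ 2) (fun n => β n / n) L) (∫⁻ l in Ioi L, f l).toReal := by
  have hα0 : α 0 = 0 := by simpa using hα 0
  have hβ0 : β 0 = 0 := by simpa using hβ 0
  set F : ℕ → ℝ → ℝ := fun n l => tm α β l n with hF
  have hC : 0 ≤ C := by have := hβ 1; simp at this; exact (abs_nonneg _).trans this
  have hInt0 : ∀ n, IntegrableOn (F n) (Ioi L) ∧ ∫ l in Ioi L, F n l
      = tm (fun n => α n / n + β n / n ^ 2) (fun n => β n / n) L n := by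
    intro n
    rcases eq_or_ne n 0 with rfl | hn
    · simp [hF, tm, hα0, hβ0]
    · exact tm_int hn _ _ _
  have hnorm : ∀ n : ℕ, ∫ l in Ioi L, ‖F n l‖ ≤ (3 * C) * (1 / ((n:ℝ) * √n)) := by
    intro n
    rcases eq_or_ne n 0 with rfl | hn
    · simp [hF, tm, hα0, hβ0]
    have hn' : (0:ℝ) < n := by positivity
    obtain ⟨i1, i2⟩ := tm_int hn |α n| |β n| L
    calc ∫ l in Ioi L, ‖F n l‖ ≤ ∫ l in Ioi L, Real.exp (-(n * l)) * (|α n| + |β n| * l) := by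
          refine setIntegral_mono_on (hInt0 n).1.norm i1 measurableSet_Ioi fun l hl => ?_
          have hl : L < l := hl
          simp only [hF, tm, norm_mul, Real.norm_eq_abs, Real.abs_exp]
          refine mul_le_mul_of_nonneg_left ((abs_add_le _ _).trans ?_) (Real.exp_pos _).le
          rw [abs_mul, abs_of_pos (hL.trans_lt hl)]
      _ = Real.exp (-(n * L)) * (|α n| / n + |β n| / n ^ 2 + |β n| / n * L) := i2
      _ = Real.exp (-(n * L)) * (|α n| / n + |β n| / n ^ 2)
          + (n * L * Real.exp (-(n * L))) * (|β n| / n ^ 2) := by field_simp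
      _ ≤ 1 * (|α n| / n + |β n| / n ^ 2) + 1 * (|β n| / n ^ 2) := by
          gcongr
          · exact Real.exp_le_one_iff.2 (by nlinarith)
          · have h1 := Real.add_one_le_exp (n * L)
            rw [Real.exp_neg, ← div_eq_mul_inv, div_le_one (Real.exp_pos _)]; linarith
      _ ≤ 1 * (C / √n / n + C * √n / n ^ 2) + 1 * (C * √n / n ^ 2) := by
          gcongr <;> first | exact hα n | exact hβ n
      _ = _ := by
          have hs : √(n:ℝ) ^ 2 = n := Real.sq_sqrt hn'.le
          have hs0 : 0 < √(n:ℝ) := Real.sqrt_pos.2 hn'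
          field_simp
          rw [hs]; ring
  have hsum : Summable fun n => ∫ l in Ioi L, ‖F n l‖ :=
    Summable.of_nonneg_of_le (fun n => integral_nonneg fun _ => norm_nonneg _) hnorm
      (summ32.mul_left _)
  have key := hasSum_integral_of_summable_integral_norm (fun n => (hInt0 n).1) hsum
  have hfin : (∫⁻ l in Ioi L, f l) ≠ ⊤ := by
    have : (∫⁻ l in Ioi L, f l) ≤ ∑' n, ∫⁻ l in Ioi L, ‖F n l‖ₑ := by
      rw [← lintegral_tsum fun n => (hInt0 n).1.aestronglyMeasurable.enorm]
      refine setLIntegral_mono_ae' measurableSet_Ioi (Eventually.of_forall fun l hl => ?_)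
      obtain ⟨h1, h2⟩ := h l (hL.trans_lt hl)
      have h3 := h2.tsum_eq
      calc f l = ENNReal.ofReal (f l).toReal := (ENNReal.ofReal_toReal h1).symm
        _ = ‖∑' n, F n l‖ₑ := by
            rw [h3, Real.enorm_of_nonneg ENNReal.toReal_nonneg]
        _ ≤ _ := enorm_tsum_le_tsum_enorm
    refine ne_top_of_le_ne_top ?_ this
    simp_rw [← fun n => ofReal_integral_norm_eq_lintegral_enorm (hInt0 n).1]
    exact hsum.tsum_ofReal_ne_top
  refine ⟨hfin, ?_⟩
  rw [← integral_toReal hf.aemeasurable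
    ((ae_restrict_mem measurableSet_Ioi).mono fun l hl => (h l (hL.trans_lt hl)).1.lt_top)]
  rw [show tm _ _ L = fun n => ∫ l in Ioi L, F n l from funext fun n => (hInt0 n).2.symm]
  rw [show ∫ l in Ioi L, (f l).toReal = ∫ l in Ioi L, ∑' n, F n l from
    setIntegral_congr_fun measurableSet_Ioi fun l hl => (h l (hL.trans_lt hl)).2.tsum_eq.symm]
  exact key


def RepW (f : ℝ → ENNReal) (α β : ℕ → ℝ) (C : ℝ) : Prop :=
  (∀ n : ℕ, |α n| ≤ C / (n * √n)) ∧ (∀ n : ℕ, |β n| ≤ C / √n) ∧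
    ∀ L, 0 ≤ L → f L ≠ ⊤ ∧ HasSum (tm α β L) (f L).toReal

def RepE (f : ℝ → ENNReal) : Prop := ∃ α β C, RepW f α β C

noncomputable def JI (f : ℝ → ENNReal) : ℝ → ENNReal := fun L => ∫⁻ l in Ioi L, f l

theorem JI_meas (f : ℝ → ENNReal) : Measurable (JI f) := by
  have : Antitone (JI f) := fun a b h => lintegral_mono_set (Ioi_subset_Ioi h)
  exact this.measurable

theorem RepW.C_nonneg {f α β C} (h : RepW f α β C) : 0 ≤ C := by
  have := h.2.1 1; simp at this; exact (abs_nonneg _).trans this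

theorem RepW.of_core {α β : ℕ → ℝ} {C : ℝ} (hα : ∀ n : ℕ, |α n| ≤ C / √n) (hβ : ∀ n : ℕ, |β n| ≤ C * √n)
    {f : ℝ → ENNReal} (hf : Measurable f)
    (h : ∀ l, 0 < l → f l ≠ ⊤ ∧ HasSum (tm α β l) (f l).toReal) :
    RepW (JI f) (fun n => α n / n + β n / n ^ 2) (fun n => β n / n) (2 * C) := by
  have hC : 0 ≤ C := by have := hβ 1; simp at this; exact (abs_nonneg _).trans this
  refine ⟨fun n => ?_, fun n => ?_, fun L hL => int_core hα hβ hf h hL⟩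
  all_goals
    rcases eq_or_ne n 0 with rfl | hn
    · simp
    have hn' : (0:ℝ) < n := by positivity
    have hs : √(n:ℝ) ^ 2 = n := Real.sq_sqrt hn'.le
    have hs0 : 0 < √(n:ℝ) := Real.sqrt_pos.2 hn'
  · calc |α n / n + β n / n ^ 2| ≤ |α n| / n + |β n| / n ^ 2 := by
          refine (abs_add_le _ _).trans ?_
          rw [abs_div, abs_div, abs_of_pos hn', abs_of_pos (by positivity : (0:ℝ) < n ^ 2)]
      _ ≤ C / √n / n + C * √n / n ^ 2 := by
          gcongr <;> first | exact hα n | exact hβ n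
      _ = _ := by field_simp; rw [hs]; ring
  · calc |β n / n| = |β n| / n := by rw [abs_div, abs_of_pos hn']
      _ ≤ C * √n / n := by gcongr; exact hβ n
      _ ≤ 2 * C / √n := by
          rw [div_le_div_iff₀ hn' hs0, mul_assoc, ← sq, hs]; nlinarith

theorem RepW.weaken {f α β C} (h : RepW f α β C) :
    (∀ n : ℕ, |α n| ≤ C / √n) ∧ (∀ n : ℕ, |β n| ≤ C * √n) := by
  have hC := h.C_nonneg
  constructor <;> intro n <;> rcases eq_or_ne n 0 with rfl | hn
  · simpa using h.1 0
  · have h1 : (1:ℝ) ≤ n := by exact_mod_cast Nat.one_le_iff_ne_zero.2 hn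
    have hs0 : 0 < √(n:ℝ) := Real.sqrt_pos.2 (by linarith)
    refine (h.1 n).trans ?_
    gcongr
    nlinarith
  · simpa using h.2.1 0
  · have h1 : (1:ℝ) ≤ n := by exact_mod_cast Nat.one_le_iff_ne_zero.2 hn
    have hs1 : 1 ≤ √(n:ℝ) := Real.one_le_sqrt.2 h1
    refine (h.2.1 n).trans ?_
    exact (div_le_self hC hs1).trans (by nlinarith)

theorem RepW.int {f α β C} (hf : Measurable f) (h : RepW f α β C) :
    RepW (JI f) (fun n => α n / n + β n / n ^ 2) (fun n => β n / n) (2 * C) :=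
  RepW.of_core h.weaken.1 h.weaken.2 hf fun l hl => h.2.2 l hl.le

theorem RepE.int {f} (hf : Measurable f) (h : RepE f) : RepE (JI f) := by
  obtain ⟨α, β, C, h⟩ := h; exact ⟨_, _, _, h.int hf⟩

theorem tm_sub (α β α' β' : ℕ → ℝ) (L : ℝ) :
    tm (fun n => α n - α' n) (fun n => β n - β' n) L = fun n => tm α β L n - tm α' β' L n := by
  ext n; simp only [tm]; ring

theorem RepE.sub {f g h : ℝ → ENNReal} (e : ∀ L, 0 ≤ L → f L + g L = h L) (hg : RepE g) (hh : RepE h) :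
    RepE f := by
  obtain ⟨α, β, C, h1, h2, h3⟩ := hh
  obtain ⟨α', β', C', h1', h2', h3'⟩ := hg
  refine ⟨fun n => α n - α' n, fun n => β n - β' n, C + C', fun n => ?_, fun n => ?_, fun L hL => ?_⟩
  · rw [add_div]; exact (abs_sub _ _).trans (add_le_add (h1 n) (h1' n))
  · rw [add_div]; exact (abs_sub _ _).trans (add_le_add (h2 n) (h2' n))
  · have e1 := e L hL
    have hf : f L ≠ ⊤ := ne_top_of_le_ne_top (h3 L hL).1 (e1 ▸ le_self_add)
    refine ⟨hf, ?_⟩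
    rw [tm_sub]
    have : (f L).toReal = (h L).toReal - (g L).toReal := by
      rw [← e1, ENNReal.toReal_add hf (h3' L hL).1]; ring
    rw [this]
    exact (h3 L hL).2.sub (h3' L hL).2

theorem sqrt_step1 {n : ℕ} (hn : n ≠ 0) : 1 / √(n:ℝ) ≤ 4 * (√((n:ℝ) + 1) - √n) := by
  have h1 : (1:ℝ) ≤ n := by exact_mod_cast Nat.one_le_iff_ne_zero.2 hn
  have hs0 : 0 < √(n:ℝ) := Real.sqrt_pos.2 (by linarith)
  have hs : √(n:ℝ) ^ 2 = n := Real.sq_sqrt (by linarith)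
  have ht : √((n:ℝ)+1) ^ 2 = n + 1 := Real.sq_sqrt (by linarith)
  have ht0 : 0 < √((n:ℝ)+1) := Real.sqrt_pos.2 (by linarith)
  have h2 : √((n:ℝ)+1) ≤ 2 * √n := by
    rw [Real.sqrt_le_left (by positivity)]; nlinarith
  rw [div_le_iff₀ hs0]
  set s := √(n:ℝ); set t := √((n:ℝ)+1)
  have h3 : (t - s) * (t + s) = 1 := by nlinarith
  have h4 : s ≤ t := by nlinarith
  nlinarith [mul_nonneg (sub_nonneg.2 h4) (by linarith : 0 ≤ 4 * s - (t + s))]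

theorem sqrt_step2 {n : ℕ} (hn : n ≠ 0) :
    1 / ((n:ℝ) * √(n:ℝ)) ≤ 8 * (1 / √n - 1 / √((n:ℝ) + 1)) := by
  have h1 : (1:ℝ) ≤ n := by exact_mod_cast Nat.one_le_iff_ne_zero.2 hn
  have hs0 : 0 < √(n:ℝ) := Real.sqrt_pos.2 (by linarith)
  have hs : √(n:ℝ) ^ 2 = n := Real.sq_sqrt (by linarith)
  have ht0 : 0 < √((n:ℝ)+1) := Real.sqrt_pos.2 (by linarith)
  have h2 : √((n:ℝ)+1) ≤ 2 * √n := by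
    rw [Real.sqrt_le_left (by positivity)]; nlinarith
  have h3 := sqrt_step1 hn
  have e : 1 / √(n:ℝ) - 1 / √((n:ℝ) + 1) = (√((n:ℝ)+1) - √n) / (√n * √((n:ℝ)+1)) := by
    field_simp
  rw [e]
  calc 1 / ((n:ℝ) * √(n:ℝ)) = (1 / √n) / n := by field_simp
    _ ≤ 4 * (√((n:ℝ) + 1) - √n) / n := by gcongr
    _ = 8 * (√((n:ℝ) + 1) - √n) / (√n * (2 * √n)) := by 
      rw [show √(n:ℝ) * (2 * √n) = 2 * n by nlinarith]; field_simp; ring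
    _ ≤ 8 * (√((n:ℝ) + 1) - √n) / (√n * √((n:ℝ)+1)) := by
      have : 0 ≤ √((n:ℝ) + 1) - √n := sub_nonneg.2 (Real.sqrt_le_sqrt (by linarith))
      gcongr
    _ = _ := by ring

/-- The key step: dividing by `e^l - 1` and integrating. -/
theorem RepE.key {α β : ℕ → ℝ} {C κ lam : ℝ} (hα : ∀ n : ℕ, |α n| ≤ C / (n * √n))
    (hβ : ∀ n : ℕ, |β n| ≤ C / √n) {D : ℝ → ℝ} (hD0 : D 0 = 0)
    (hD : ∀ l, 0 ≤ l → HasSum (tm α β l) (D l - κ - lam * l))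
    {G : ℝ → ENNReal} (hG : Measurable G)
    (h : ∀ l, 0 < l → G l ≠ ⊤ ∧ (Real.exp l - 1) * (G l).toReal = D l) : RepE (JI G) := by
  have hC : 0 ≤ C := by have := hβ 1; simp at this; exact (abs_nonneg _).trans this
  have hα0 : α 0 = 0 := by simpa using hα 0
  have hβ0 : β 0 = 0 := by simpa using hβ 0
  set P : ℕ → ℝ := fun N => if N = 0 then 0 else κ + ∑ n ∈ Finset.range N, α n with hP
  set Q : ℕ → ℝ := fun N => if N = 0 then 0 else lam + ∑ n ∈ Finset.range N, β n with hQ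
  have hPs : ∀ N, P (N+1) = P N + α N + if N = 0 then κ else 0 := by
    intro N; rcases eq_or_ne N 0 with rfl | hN
    · simp [hP, hα0]
    · simp [hP, hN, Finset.sum_range_succ]; ring
  have hQs : ∀ N, Q (N+1) = Q N + β N + if N = 0 then lam else 0 := by
    intro N; rcases eq_or_ne N 0 with rfl | hN
    · simp [hQ, hβ0]
    · simp [hQ, hN, Finset.sum_range_succ]; ring
  have hsα : HasSum α (-κ) := by
    have := hD 0 le_rfl
    rw [hD0] at this
    rw [show tm α β 0 = α from funext fun n => by simp [tm]] at this
    simpa using this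
  have hPlim : Tendsto P atTop (𝓝 0) := by
    have := (hsα.tendsto_sum_nat.const_add κ)
    rw [add_neg_cancel] at this
    refine this.congr' ?_
    filter_upwards [eventually_ne_atTop 0] with N hN
    simp [hP, hN]
  have hPb : ∀ N : ℕ, |P N| ≤ 8 * C / √N := by
    intro N
    rcases eq_or_ne N 0 with rfl | hN
    · simp [hP]
    have h1 : ∀ k, |P (N + k) - P N| ≤ 8 * C * (1 / √(N:ℝ) - 1 / √((N + k : ℕ) : ℝ)) := by
      intro k
      induction k with
      | zero => simp
      | succ k ih =>
        have hk : N + k ≠ 0 := by omega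
        have e := hPs (N + k)
        rw [if_neg hk, add_zero] at e
        rw [← add_assoc, e]
        have h2 := sqrt_step2 hk
        have h3 := hα (N + k)
        have h4 : C / (((N + k : ℕ):ℝ) * √((N + k : ℕ):ℝ))
          ≤ 8 * C * (1 / √((N + k : ℕ) : ℝ) - 1 / √((N + k : ℕ) + 1 : ℝ)) := by
          rw [div_eq_mul_one_div]; nlinarith
        have h5 : |P (N + k) + α (N + k) - P N| ≤ |P (N + k) - P N| + |α (N + k)| := by
          rw [add_sub_right_comm]; exact abs_add_le _ _
        rw [Nat.cast_succ (N + k)]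
        nlinarith
    have h2 : Tendsto (fun k => |P (N + k) - P N|) atTop (𝓝 |0 - P N|) := by
      refine ((Tendsto.comp hPlim ?_).sub_const _).abs
      exact tendsto_atTop_mono (fun k => Nat.le_add_left k N) tendsto_id
    rw [zero_sub, abs_neg] at h2
    refine le_of_tendsto h2 (Eventually.of_forall fun k => (h1 k).trans ?_)
    rw [div_eq_mul_one_div (8 * C)]
    have : 0 ≤ 1 / √((N + k : ℕ) : ℝ) := by positivity
    gcongr; linarith
  have hQb : ∀ N : ℕ, |Q N| ≤ (|lam| + 4 * C) * √N := by
    intro N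
    have h1 : |Q N| ≤ (if N = 0 then 0 else |lam|) + 4 * C * √N := by
      induction N with
      | zero => simp [hQ]
      | succ N ih =>
        rcases eq_or_ne N 0 with rfl | hN
        · simp [hQ, hβ0]; positivity
        · have e := hQs N
          rw [if_neg hN, add_zero] at e
          rw [if_neg hN] at ih
          rw [if_neg (by omega), e, Nat.cast_succ]
          have h2 := sqrt_step1 hN
          have h3 := hβ N
          have h4 : C / √(N:ℝ) ≤ 4 * C * (√((N:ℝ)+1) - √N) := by
            rw [div_eq_mul_one_div]; nlinarith
          have := abs_add_le (Q N) (β N)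
          linarith
    rcases eq_or_ne N 0 with rfl | hN
    · simpa using h1
    · rw [if_neg hN] at h1
      have : 1 ≤ √(N:ℝ) := Real.one_le_sqrt.2 (by exact_mod_cast Nat.one_le_iff_ne_zero.2 hN)
      nlinarith [abs_nonneg lam]
  have hP0 : P 0 = 0 := by simp [hP]
  have hQ0 : Q 0 = 0 := by simp [hQ]
  refine ⟨_, _, _, RepW.of_core (α := P) (β := Q) (C := |lam| + 8 * C) (fun n => ?_) (fun n => ?_) hG fun l hl => ?_⟩
  · refine (hPb n).trans ?_
    gcongr; linarith [abs_nonneg lam]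
  · refine (hQb n).trans ?_
    gcongr; linarith
  · obtain ⟨hG1, hG2⟩ := h l hl
    refine ⟨hG1, ?_⟩
    have hS : Summable (tm P Q l) := by
      have hr : ‖Real.exp (-l)‖ < 1 := by
        rw [Real.norm_eq_abs, Real.abs_exp]; simpa using hl
      have hg := (summable_pow_mul_geometric_of_norm_lt_one 1 hr).mul_left
        ((|lam| + 8 * C) * (1 + l))
      have hb : ∀ N : ℕ, |P N| ≤ (|lam| + 8 * C) * N ∧ |Q N| ≤ (|lam| + 8 * C) * N := by
        intro N
        rcases eq_or_ne N 0 with rfl | hN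
        · simp [hP0, hQ0]
        have h1 : (1:ℝ) ≤ N := by exact_mod_cast Nat.one_le_iff_ne_zero.2 hN
        have hs1 : 1 ≤ √(N:ℝ) := Real.one_le_sqrt.2 h1
        have hs : √(N:ℝ) ^ 2 = N := Real.sq_sqrt (by linarith)
        constructor
        · refine (hPb N).trans ((div_le_self (by positivity) hs1).trans ?_)
          nlinarith [abs_nonneg lam]
        · refine (hQb N).trans ?_
          have : √(N:ℝ) ≤ N := by nlinarith
          have h5 := abs_nonneg lam
          gcongr; linarith
      refine Summable.of_norm_bounded hg fun N => ?_
      obtain ⟨b1, b2⟩ := hb N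
      simp only [tm, norm_mul, Real.norm_eq_abs, Real.abs_exp]
      rw [← Real.exp_nat_mul, pow_one, mul_neg]
      have : |P N + Q N * l| ≤ (|lam| + 8 * C) * (1 + l) * N := by
        refine (abs_add_le _ _).trans ?_
        rw [abs_mul, abs_of_pos hl]
        nlinarith
      calc Real.exp (-(N * l)) * |P N + Q N * l| ≤ Real.exp (-(N * l)) * ((|lam| + 8 * C) * (1 + l) * N) := by
            gcongr
        _ = _ := by ring
    obtain ⟨S, hS⟩ := hS
    have h1 : HasSum (fun N => tm P Q l (N + 1)) S := by
      rw [hasSum_nat_add_iff' 1 |>.symm] at hS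
      simpa [tm, hP0, hQ0] using hS
    have h2 : HasSum (fun N => Real.exp l * tm P Q l (N + 1) - tm P Q l N) (Real.exp l * S - S) :=
      (h1.mul_left _).sub hS
    have h3 : HasSum (fun N => tm α β l N + if N = 0 then κ + lam * l else 0)
        ((D l - κ - lam * l) + (κ + lam * l)) :=
      (hD l hl.le).add (hasSum_ite_eq 0 _)
    have h4 : (fun N => Real.exp l * tm P Q l (N + 1) - tm P Q l N)
        = (fun N => tm α β l N + if N = 0 then κ + lam * l else 0) := by
      ext N
      have e : Real.exp (-(((N + 1 : ℕ):ℝ) * l)) = Real.exp (-(N * l)) * Real.exp (-l) := by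
        rw [← Real.exp_add]; congr 1; push_cast; ring
      have e2 : Real.exp l * Real.exp (-l) = 1 := by rw [← Real.exp_add]; simp
      simp only [tm]
      rw [e, hPs, hQs]
      have : ∀ y, Real.exp l * (Real.exp (-(N * l)) * Real.exp (-l) * y) = Real.exp (-(N * l)) * y := by
        intro y; linear_combination (Real.exp (-(N * l)) * y) * e2
      rw [this]
      split_ifs with hN
      · subst hN; simp [hP0, hQ0]; ring
      · ring
    rw [h4] at h2
    have h5 := h2.unique h3
    have h6 : (Real.exp l - 1) * S = (Real.exp l - 1) * (G l).toReal := by rw [hG2]; linarith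
    have h7 : Real.exp l - 1 ≠ 0 := by
      have := Real.add_one_lt_exp hl.ne'; linarith
    rw [← mul_left_cancel₀ h7 h6]
    exact hS


noncomputable def om (b : Bool) (p : ℝ) : ENNReal :=
  ENNReal.ofReal (if b then Real.sigmoid p else 1 - Real.sigmoid p)

noncomputable def II : List Bool → ℝ → ENNReal
  | [], _ => 1
  | a :: A, p => ∫⁻ q in Iio p, om a q * II A q

noncomputable def JJ : List Bool → ℝ → ENNReal
  | [], _ => 1
  | b :: B, p => ∫⁻ q in Ioi p, om b q * JJ B q

noncomputable def TT (a : Bool) (A B : List Bool) (L : ℝ) : ENNReal :=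
  ∫⁻ p, om a p * II A p * JJ B (p + L)

noncomputable def GG (A B : List Bool) (l : ℝ) : ENNReal :=
  ∫⁻ p, om true p * II A p * (om false (p + l) * JJ B (p + l))

@[fun_prop]
theorem om_meas (b : Bool) : Measurable (om b) := by
  unfold om
  have := continuous_sigmoid.measurable
  cases b <;> simp <;> fun_prop

theorem om_add (p : ℝ) : om false p + om true p = 1 := by
  simp only [om]
  rw [← ENNReal.ofReal_add] <;> simp [Real.sigmoid_le_one, Real.sigmoid_nonneg]

@[fun_prop]
theorem II_meas (A : List Bool) : Measurable (II A) := by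
  cases A with
  | nil => exact measurable_const
  | cons a A =>
    have : Monotone (II (a :: A)) := fun a b h => lintegral_mono_set (Iio_subset_Iio h)
    exact this.measurable

theorem JJ_anti (A : List Bool) : Antitone (JJ A) := by
  cases A with
  | nil => exact fun _ _ _ => le_rfl
  | cons a A =>
    exact fun a b h => lintegral_mono_set (Ioi_subset_Ioi h)

@[fun_prop]
theorem JJ_meas (A : List Bool) : Measurable (JJ A) := (JJ_anti A).measurable

theorem TT_meas (a A B) : Measurable (TT a A B) := by
  have : Antitone (TT a A B) := fun x y h => lintegral_mono fun p => by
    dsimp only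
    gcongr
    exact JJ_anti B (by linarith)
  exact this.measurable

theorem GG_meas (A B) : Measurable (GG A B) := by
  unfold GG
  apply Measurable.lintegral_prod_right' (f := fun z : ℝ × ℝ => om true z.2 * II A z.2 *
    (om false (z.2 + z.1) * JJ B (z.2 + z.1)))
  fun_prop

theorem shift_Ioi (h : ℝ → ENNReal) (p L : ℝ) :
    ∫⁻ q in Ioi (p + L), h q = ∫⁻ l in Ioi L, h (p + l) := by
  rw [← lintegral_indicator measurableSet_Ioi, ← lintegral_indicator measurableSet_Ioi,
    ← lintegral_add_left_eq_self _ p]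
  congr 1; ext q
  simp [indicator]

theorem shift_Ioi' (h : ℝ → ENNReal) (p L : ℝ) :
    ∫⁻ q in Ioi (p + L), h q = ∫⁻ q in Ioi p, h (q + L) := by
  rw [add_comm, shift_Ioi]; simp_rw [add_comm]

theorem swap_tri {f h : ℝ → ENNReal} (hf : Measurable f) (hh : Measurable h) :
    ∫⁻ p, f p * ∫⁻ q in Ioi p, h q = ∫⁻ q, (∫⁻ p in Iio q, f p) * h q := by
  have e1 : ∀ p, f p * ∫⁻ q in Ioi p, h q = ∫⁻ q, {z : ℝ × ℝ | z.1 < z.2}.indicator (fun z => f z.1 * h z.2) (p, q) := by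
    intro p
    rw [← lintegral_const_mul _ hh, ← lintegral_indicator measurableSet_Ioi]
    rfl
  have e2 : ∀ q, (∫⁻ p in Iio q, f p) * h q = ∫⁻ p, {z : ℝ × ℝ | z.1 < z.2}.indicator (fun z => f z.1 * h z.2) (p, q) := by
    intro q
    rw [← lintegral_mul_const _ hf, ← lintegral_indicator measurableSet_Iio]
    rfl
  simp_rw [e1, e2]
  refine lintegral_lintegral_swap (Measurable.aemeasurable ?_)
  exact Measurable.indicator (f := fun z : ℝ × ℝ => f z.1 * h z.2) (by fun_prop)
    (measurableSet_lt measurable_fst measurable_snd)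

theorem TT_cons (a A b B L) :
    TT a A (b :: B) L = ∫⁻ p, II (a :: A) p * (om b (p + L) * JJ B (p + L)) := by
  simp only [TT, II, JJ]
  simp_rw [shift_Ioi']
  rw [swap_tri (by fun_prop) (by fun_prop)]

theorem TT_right (a A B L) : TT a A (false :: B) L + TT a A (true :: B) L = JI (TT a A B) L := by
  simp only [TT, JI, JJ]
  rw [← lintegral_add_left]
  swap
  · have : Measurable (JJ (false :: B)) := by fun_prop
    simp only [JJ] at this
    have := this.comp (measurable_id.add_const L)
    have h2 : Measurable fun p => om a p * II A p := by fun_prop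
    exact h2.mul this
  rw [lintegral_lintegral_swap (Measurable.aemeasurable (by fun_prop))]
  congr 1; ext p
  rw [← mul_add, ← lintegral_add_left (by fun_prop)]
  simp_rw [← add_mul, om_add, one_mul]
  rw [shift_Ioi, lintegral_const_mul _ (by fun_prop)]

theorem TT_left (a A B L) : TT false (a :: A) B L + TT true (a :: A) B L = JI (TT a A B) L := by
  have : TT false (a :: A) B L + TT true (a :: A) B L = ∫⁻ p, II (a :: A) p * JJ B (p + L) := by
    simp only [TT]
    rw [← lintegral_add_left (by fun_prop)]
    congr 1; ext p
    rw [← add_mul, ← add_mul, om_add, one_mul]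
  rw [this]
  simp only [II]
  rw [← swap_tri (by fun_prop) (by fun_prop)]
  simp only [TT, JI]
  rw [lintegral_lintegral_swap (Measurable.aemeasurable (by fun_prop))]
  congr 1; ext p
  rw [← shift_Ioi', shift_Ioi, lintegral_const_mul _ (by fun_prop)]

theorem TT_key (A B) : TT true A (false :: B) = JI (GG A B) := by
  ext L
  simp only [TT, JI, JJ, GG]
  rw [lintegral_lintegral_swap (Measurable.aemeasurable (by fun_prop))]
  congr 1; ext p
  rw [shift_Ioi, lintegral_const_mul _ (by fun_prop)]

theorem om_id1 {l : ℝ} (hl : 0 ≤ l) (p : ℝ) :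
    ENNReal.ofReal (Real.exp l - 1) * (om true p * om false (p + l)) + om true p = om true (p + l) := by
  simp only [om, if_true, if_false, Bool.false_eq_true]
  have h1 := Real.sigmoid_nonneg p
  have h2 := Real.sigmoid_le_one (p + l)
  have h3 : 0 ≤ Real.exp l - 1 := by have := Real.add_one_le_exp l; linarith
  rw [← ENNReal.ofReal_mul h1, ← ENNReal.ofReal_mul h3, ← ENNReal.ofReal_add
    (mul_nonneg h3 (mul_nonneg h1 (by linarith))) h1]
  congr 1
  rw [Real.sigmoid_def, Real.sigmoid_def, neg_add, Real.exp_add, Real.exp_neg p, Real.exp_neg l]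
  have := Real.exp_pos p
  have := Real.exp_pos l
  field_simp
  ring

theorem om_id2 {l : ℝ} (hl : 0 ≤ l) (p : ℝ) :
    ENNReal.ofReal (Real.exp l - 1) * (om true p * om false (p + l)) + om false (p + l) = om false p := by
  have h := om_id1 hl p
  have h1 := om_add p
  have h2 := om_add (p + l)
  have h3 : om true p ≠ ⊤ := ENNReal.ofReal_ne_top
  rw [← h] at h2
  have : om false p + om true p = (ENNReal.ofReal (Real.exp l - 1) * (om true p * om false (p + l)) + om false (p + l)) + om true p := by
    rw [h1, ← h2]; ring
  exact ((ENNReal.add_left_inj h3).1 this).symm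

theorem GG_1 (A B) {l : ℝ} (hl : 0 ≤ l) :
    ENNReal.ofReal (Real.exp l - 1) * GG A B l + TT true A B l
      = ∫⁻ p, II A p * (om true (p + l) * JJ B (p + l)) := by
  unfold GG TT
  rw [← lintegral_const_mul _ (by fun_prop), ← lintegral_add_left (by fun_prop)]
  congr 1; ext p
  rw [← om_id1 hl p]; ring

theorem GG_2 (A) {l : ℝ} (hl : 0 ≤ l) :
    ENNReal.ofReal (Real.exp l - 1) * GG A [] l + ∫⁻ p, II A p * (om false (p + l) * JJ [] (p + l))
      = ∫⁻ p, II A p * om false p := by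
  unfold GG
  rw [← lintegral_const_mul _ (by fun_prop), ← lintegral_add_left (by fun_prop)]
  congr 1; ext p
  rw [← om_id2 hl p]; simp only [JJ]; ring

theorem sig_eq (p : ℝ) : Real.sigmoid p = Real.exp p / (1 + Real.exp p) := by
  rw [Real.sigmoid_def, Real.exp_neg]
  have := Real.exp_pos p
  field_simp
  ring

theorem GG_3 {l : ℝ} (hl : 0 ≤ l) :
    ENNReal.ofReal (Real.exp l - 1) * GG [] [] l = ENNReal.ofReal l := by
  have h1 : ∫⁻ p, ENNReal.ofReal (Real.sigmoid (p + l) - Real.sigmoid p) = ENNReal.ofReal (l - 0) := by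
    have hpos : ∀ p : ℝ, 0 < 1 + Real.exp p := fun p => by positivity
    have hd : ∀ p : ℝ, HasDerivAt (fun p => Real.log (1 + Real.exp p)) (Real.sigmoid p) p := by
      intro p
      rw [sig_eq]
      exact ((Real.hasDerivAt_exp p).const_add 1).log (hpos p).ne'
    have hbot : Tendsto (fun p => Real.log (1 + Real.exp p)) atBot (𝓝 0) := by
      have : Tendsto (fun p => 1 + Real.exp p) atBot (𝓝 (1 + 0)) := Real.tendsto_exp_atBot.const_add 1
      have := this.log (by norm_num)
      simpa using this
    have htop : Tendsto (fun p => Real.log (1 + Real.exp p) - p) atTop (𝓝 0) := by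
      have : (fun p => Real.log (1 + Real.exp p) - p) = (fun p => Real.log (1 + Real.exp p)) ∘ Neg.neg := by
        ext p
        have : 1 + Real.exp p = Real.exp p * (1 + Real.exp (-p)) := by
          rw [mul_add, ← Real.exp_add]; simp; ring
        simp only [Function.comp]
        rw [this, Real.log_mul (Real.exp_pos p).ne' (hpos _).ne', Real.log_exp]; ring
      rw [this]; exact hbot.comp tendsto_neg_atTop_atBot
    refine ftc_univ (g := fun p => Real.log (1 + Real.exp (p + l)) - Real.log (1 + Real.exp p))
      (fun p => ((hd (p + l)).comp_add_const p l).sub (hd p)) (fun p => ?_) ?_ ?_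
    · exact sub_nonneg.2 (Real.sigmoid_le (by linarith))
    · have := (hbot.comp (tendsto_atBot_add_const_right atBot l tendsto_id)).sub hbot
      simpa using! this
    · have := ((htop.comp (tendsto_atTop_add_const_right atTop l tendsto_id)).sub htop).add_const l
      simp only [sub_zero, zero_add] at this
      refine this.congr fun p => ?_
      simp only [Function.comp, id]; ring
  rw [sub_zero] at h1
  rw [← h1, GG, ← lintegral_const_mul _ (by fun_prop)]
  congr 1; ext p
  simp only [II, JJ, mul_one]
  have := om_id1 hl p
  rw [ENNReal.ofReal_sub _ (Real.sigmoid_nonneg p)]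
  have e : ∀ p, om true p = ENNReal.ofReal (Real.sigmoid p) := fun p => by simp [om]
  rw [← e, ← e, ← this, ENNReal.add_sub_cancel_right (show om true p ≠ ⊤ from ENNReal.ofReal_ne_top)]

theorem key_lift {G t1 t2 : ENNReal} {e : ℝ} (he : 0 < e) (h1 : t1 ≠ ⊤) (h2 : t2 ≠ ⊤)
    (h : ENNReal.ofReal e * G + t1 = t2) : G ≠ ⊤ ∧ e * G.toReal = t2.toReal - t1.toReal := by
  have hG : G ≠ ⊤ := by
    rintro rfl
    rw [ENNReal.mul_top (by simpa using he)] at h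
    simp at h; exact h2 h.symm
  refine ⟨hG, ?_⟩
  rw [← h, ENNReal.toReal_add (ENNReal.mul_ne_top ENNReal.ofReal_ne_top hG) h1, ENNReal.toReal_mul,
    ENNReal.toReal_ofReal he.le]; ring

theorem exp_sub_pos {l : ℝ} (hl : 0 < l) : 0 < Real.exp l - 1 := by
  have := Real.add_one_lt_exp hl.ne'; linarith

theorem TT_nil_E (B) (l : ℝ) : ∫⁻ p, II [] p * (om true (p + l) * JJ B (p + l)) = TT true [] B 0 := by
  simp only [II, TT, one_mul, mul_one, add_zero]
  exact lintegral_add_right_eq_self (fun p => om true p * JJ B p) l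

/-- Main representation, case `(A y, x B)`. -/
theorem rep_yx (A B : List Bool)
    (h1 : B ≠ [] → RepE (TT true A B))
    (h2 : B ≠ [] → ∀ a A', A = a :: A' → RepE (TT a A' (true :: B)))
    (h3 : B = [] → ∀ a A', A = a :: A' → RepE (TT a A' [false])) :
    RepE (TT true A (false :: B)) := by
  rw [TT_key]
  rcases eq_or_ne B [] with rfl | hB
  · cases A with
    | nil =>
      refine RepE.key (α := 0) (β := 0) (C := 0) (κ := 0) (lam := 1) (D := fun l => l) (by simp) (by simp) rfl
        (fun l _ => ?_) (GG_meas _ _) fun l hl => ?_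
      · have : tm 0 0 l = fun _ => 0 := by ext n; simp [tm]
        rw [this]; simpa using hasSum_zero
      · have := key_lift (exp_sub_pos hl) (t1 := 0) (by simp) ENNReal.ofReal_ne_top
          (by rw [add_zero]; exact GG_3 hl.le)
        simpa [ENNReal.toReal_ofReal hl.le] using this
    | cons a A =>
      obtain ⟨α, β, C, r1, r2, r3⟩ := h3 rfl a A rfl
      have e0 : ∫⁻ p, II (a :: A) p * om false p = TT a A [false] 0 := by
        rw [TT_cons]; simp [JJ]
      refine RepE.key (α := fun n => - α n) (β := fun n => - β n) (C := C) (κ := (TT a A [false] 0).toReal)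
        (lam := 0) (D := fun l => (TT a A [false] 0).toReal - (TT a A [false] l).toReal)
        (by simpa using r1) (by simpa using r2) (by simp)
        (fun l hl => ?_) (GG_meas _ _) fun l hl => ?_
      · rw [show tm (fun n => - α n) (fun n => - β n) l = fun n => - tm α β l n from
          funext fun n => by simp only [tm]; ring]
        have e : (TT a A [false] 0).toReal - (TT a A [false] l).toReal - (TT a A [false] 0).toReal - 0 * l
            = -(TT a A [false] l).toReal := by ring
        simp only [e]
        exact (r3 l hl).2.neg
      · refine key_lift (exp_sub_pos hl) (r3 l hl.le).1 (r3 0 le_rfl).1 ?_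
        rw [TT_cons a A false [] l, GG_2 _ hl.le, e0]
  · obtain ⟨α, β, C, r1, r2, r3⟩ := h1 hB
    cases A with
    | nil =>
      refine RepE.key (α := fun n => - α n) (β := fun n => - β n) (C := C) (κ := (TT true [] B 0).toReal)
        (lam := 0) (D := fun l => (TT true [] B 0).toReal - (TT true [] B l).toReal)
        (by simpa using r1) (by simpa using r2) (by simp)
        (fun l hl => ?_) (GG_meas _ _) fun l hl => ?_
      · rw [show tm (fun n => - α n) (fun n => - β n) l = fun n => - tm α β l n from
          funext fun n => by simp only [tm]; ring]
        have e : (TT true [] B 0).toReal - (TT true [] B l).toReal - (TT true [] B 0).toReal - 0 * l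
            = -(TT true [] B l).toReal := by ring
        simp only [e]
        exact (r3 l hl).2.neg
      · refine key_lift (exp_sub_pos hl) (r3 l hl.le).1 (r3 0 le_rfl).1 ?_
        rw [GG_1 _ _ hl.le, TT_nil_E]
    | cons a A =>
      obtain ⟨α', β', C', r1', r2', r3'⟩ := h2 hB a A rfl
      refine RepE.key (α := fun n => α' n - α n) (β := fun n => β' n - β n) (C := C' + C) (κ := 0)
        (lam := 0) (D := fun l => (TT a A (true :: B) l).toReal - (TT true (a :: A) B l).toReal)
        (fun n => ?_) (fun n => ?_) ?_
        (fun l hl => ?_) (GG_meas _ _) fun l hl => ?_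
      · rw [add_div]; exact (abs_sub _ _).trans (add_le_add (r1' n) (r1 n))
      · rw [add_div]; exact (abs_sub _ _).trans (add_le_add (r2' n) (r2 n))
      · have := GG_1 (a :: A) B (le_refl (0:ℝ))
        rw [← TT_cons] at this
        simp at this
        simp [this]
      · rw [tm_sub]
        simpa using (r3' l hl).2.sub (r3 l hl).2
      · refine key_lift (exp_sub_pos hl) (r3 l hl.le).1 (r3' l hl.le).1 ?_
        rw [GG_1 _ _ hl.le, TT_cons]

theorem rep_all (N : ℕ) : ∀ (a : Bool) (A B : List Bool), A.length + B.length ≤ N →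
    (a :: A).getLast? = some true → B.getLast? = some false → RepE (TT a A B) := by
  induction N with
  | zero =>
    intro a A B hN _ hB
    have : B = [] := List.eq_nil_of_length_eq_zero (by omega)
    simp [this] at hB
  | succ N ih =>
    have yx : ∀ (A B : List Bool), A.length + (false :: B).length ≤ N + 1 →
        (true :: A).getLast? = some true → (false :: B).getLast? = some false →
        RepE (TT true A (false :: B)) := by
      intro A B hN hA hB
      simp only [List.length_cons] at hN
      refine rep_yx A B (fun h => ih _ _ _ (by omega) hA ?_) (fun h a A' e => ?_) (fun h a A' e => ?_)
      · obtain ⟨c, B', rfl⟩ := List.exists_cons_of_ne_nil h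
        rwa [List.getLast?_cons_cons] at hB
      · subst e
        obtain ⟨c, B', rfl⟩ := List.exists_cons_of_ne_nil h
        rw [List.getLast?_cons_cons] at hA hB
        refine ih _ _ _ (by simp at hN ⊢; omega) hA ?_
        rwa [List.getLast?_cons_cons]
      · subst e
        rw [List.getLast?_cons_cons] at hA
        refine ih _ _ _ (by simp at hN ⊢; omega) hA rfl
    have ax : ∀ (a : Bool) (A B : List Bool), A.length + (false :: B).length ≤ N + 1 →
        (a :: A).getLast? = some true → (false :: B).getLast? = some false →
        RepE (TT a A (false :: B)) := by
      intro a A B hN hA hB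
      cases a with
      | true => exact yx A B hN hA hB
      | false =>
        cases A with
        | nil => simp at hA
        | cons a A =>
          rw [List.getLast?_cons_cons] at hA
          refine RepE.sub (fun L _ => TT_left a A _ L) (yx _ _ hN ?_ hB)
            ((ih a A _ (by simp at hN ⊢; omega) hA hB).int (TT_meas _ _ _))
          rwa [List.getLast?_cons_cons]
    intro a A B hN hA hB
    cases B with
    | nil => simp at hB
    | cons b B =>
      cases b with
      | false => exact ax a A B hN hA hB
      | true =>
        cases B with
        | nil => simp at hB
        | cons b B =>
          rw [List.getLast?_cons_cons] at hB
          refine RepE.sub (fun L _ => (add_comm _ _).trans (TT_right a A _ L)) (ax a A _ hN hA ?_)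
            ((ih a A _ (by simp at hN ⊢; omega) hA hB).int (TT_meas _ _ _))
          rwa [List.getLast?_cons_cons]


theorem TT_move (a a' : Bool) (A B : List Bool) : TT a (a' :: A) B 0 = TT a' A (a :: B) 0 := by
  rw [TT_cons, TT]
  congr 1; ext p
  ring

noncomputable def cc : List Bool → ℕ → ENNReal
  | [], n => if n = 0 then 1 else 0
  | a :: A, m => ENNReal.ofReal (1 / (m : ℝ)) *
      (if a then ∑ n ∈ Finset.range m, cc A n else cc A m)

theorem cc_zero (a : Bool) (A : List Bool) : cc (a :: A) 0 = 0 := by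
  simp [cc]

theorem sig_hd (m : ℕ) (hm : m ≠ 0) (q : ℝ) :
    HasDerivAt (fun q => 1 / (m : ℝ) * Real.sigmoid q ^ m)
      (Real.sigmoid q ^ m * (1 - Real.sigmoid q)) q := by
  have h := ((Real.hasDerivAt_sigmoid q).pow m).const_mul (1 / (m : ℝ))
  refine h.congr_deriv ?_
  have : (m : ℝ) ≠ 0 := by exact_mod_cast hm
  obtain ⟨k, rfl⟩ := Nat.exists_eq_succ_of_ne_zero hm
  field_simp
  simp only [Nat.succ_eq_add_one, Nat.add_sub_cancel, pow_succ]
  ring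

theorem sig_pos' (m : ℕ) (q : ℝ) : 0 ≤ Real.sigmoid q ^ m * (1 - Real.sigmoid q) :=
  mul_nonneg (pow_nonneg (Real.sigmoid_nonneg q) _) (sub_nonneg.2 (Real.sigmoid_le_one q))

theorem sig_bot (m : ℕ) (hm : m ≠ 0) :
    Tendsto (fun q => 1 / (m : ℝ) * Real.sigmoid q ^ m) atBot (𝓝 0) := by
  simpa [hm] using (Real.tendsto_sigmoid_atBot.pow m).const_mul (1 / (m : ℝ))

theorem sig_top (m : ℕ) :
    Tendsto (fun q => 1 / (m : ℝ) * Real.sigmoid q ^ m) atTop (𝓝 (1 / (m : ℝ))) := by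
  simpa using (Real.tendsto_sigmoid_atTop.pow m).const_mul (1 / (m : ℝ))

theorem int_Iio (d : ℕ → ENNReal) (h0 : d 0 = 0) (p : ℝ) :
    ∫⁻ q in Iio p, ∑' m, d m * ENNReal.ofReal (Real.sigmoid q ^ m * (1 - Real.sigmoid q)) =
      ∑' m : ℕ, ENNReal.ofReal (1 / (m : ℝ)) * d m * ENNReal.ofReal (Real.sigmoid p ^ m) := by
  have hc := continuous_sigmoid.measurable
  rw [lintegral_tsum (fun m => by fun_prop)]
  refine tsum_congr fun m => ?_
  rw [lintegral_const_mul _ (by fun_prop)]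
  rcases eq_or_ne m 0 with rfl | hm
  · simp [h0]
  · rw [ftc_Iio p (fun q => sig_hd m hm q) (fun q => sig_pos' m q) (sig_bot m hm), sub_zero,
      ENNReal.ofReal_mul (by positivity)]
    ring

theorem int_univ (d : ℕ → ENNReal) (h0 : d 0 = 0) :
    ∫⁻ q, ∑' m, d m * ENNReal.ofReal (Real.sigmoid q ^ m * (1 - Real.sigmoid q)) =
      ∑' m : ℕ, ENNReal.ofReal (1 / (m : ℝ)) * d m := by
  have hc := continuous_sigmoid.measurable
  rw [lintegral_tsum (fun m => by fun_prop)]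
  refine tsum_congr fun m => ?_
  rw [lintegral_const_mul _ (by fun_prop)]
  rcases eq_or_ne m 0 with rfl | hm
  · simp [h0]
  · rw [ftc_univ (fun q => sig_hd m hm q) (fun q => sig_pos' m q) (sig_bot m hm) (sig_top m), sub_zero]
    ring

theorem sig_geom (n : ℕ) (q : ℝ) : ENNReal.ofReal (Real.sigmoid q * Real.sigmoid q ^ n) =
    ∑' m, (if n < m then ENNReal.ofReal (Real.sigmoid q ^ m * (1 - Real.sigmoid q)) else 0) := by
  have h1 := Real.sigmoid_lt_one q
  have h0 := Real.sigmoid_nonneg q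
  have hs := ((hasSum_geometric_of_lt_one h0 h1).mul_left (Real.sigmoid q ^ (n+1))).mul_right (1 - Real.sigmoid q)
  rw [mul_assoc, inv_mul_cancel₀ (by linarith), mul_one] at hs
  have e : ENNReal.ofReal (Real.sigmoid q * Real.sigmoid q ^ n) =
      ∑' j : ℕ, ENNReal.ofReal (Real.sigmoid q ^ (j + (n+1)) * (1 - Real.sigmoid q)) := by
    rw [← ENNReal.ofReal_tsum_of_nonneg (fun j => sig_pos' _ q)]
    · congr 1
      rw [← pow_succ', ← hs.tsum_eq]
      refine tsum_congr fun j => by ring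
    · exact hs.summable.congr fun j => by ring
  rw [e, ← (ENNReal.summable).sum_add_tsum_nat_add' (k := n + 1)
    (f := fun m => if n < m then ENNReal.ofReal (Real.sigmoid q ^ m * (1 - Real.sigmoid q)) else 0)]
  rw [Finset.sum_eq_zero, zero_add]
  · refine tsum_congr fun j => ?_
    rw [if_pos (by omega)]
  · intro i hi
    rw [Finset.mem_range] at hi
    rw [if_neg (by omega)]

theorem II_series (A : List Bool) : (A = [] ∨ A.getLast? = some true) → ∀ p,
    II A p = ∑' n, cc A n * ENNReal.ofReal (Real.sigmoid p ^ n) := by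
  induction A with
  | nil =>
    intro _ p
    rw [tsum_eq_single 0 (by intro n hn; simp [cc, hn])]
    simp [II, cc]
  | cons a A ih =>
    intro h p
    have hA : A = [] ∨ A.getLast? = some true := by
      cases A with
      | nil => simp
      | cons b A => right; simpa [List.getLast?_cons_cons] using h
    have key : ∀ q, om a q * II A q =
        ∑' m, (if a then ∑ n ∈ Finset.range m, cc A n else cc A m) *
          ENNReal.ofReal (Real.sigmoid q ^ m * (1 - Real.sigmoid q)) := by
      intro q
      rw [ih hA q, ← ENNReal.tsum_mul_left]
      cases a with
      | false =>
        refine tsum_congr fun n => ?_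
        rw [ENNReal.ofReal_mul (pow_nonneg (Real.sigmoid_nonneg q) _)]
        simp only [om, Bool.false_eq_true, if_false]
        ring
      | true =>
        have : ∀ n, om true q * (cc A n * ENNReal.ofReal (Real.sigmoid q ^ n)) =
            ∑' m, cc A n * (if n < m then ENNReal.ofReal (Real.sigmoid q ^ m * (1 - Real.sigmoid q)) else 0) := by
          intro n
          rw [ENNReal.tsum_mul_left, ← sig_geom, ENNReal.ofReal_mul (Real.sigmoid_nonneg q)]
          simp only [om, if_true]
          ring
        simp only [this]
        rw [ENNReal.tsum_comm]
        refine tsum_congr fun m => ?_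
        simp only [if_true]
        rw [tsum_eq_sum (s := Finset.range m), Finset.sum_mul]
        · refine Finset.sum_congr rfl fun n hn => ?_
          rw [if_pos (Finset.mem_range.1 hn)]
        · intro n hn
          rw [if_neg (by simpa using hn), mul_zero]
    rw [II]
    simp only [key]
    rw [int_Iio]
    · simp only [cc]
    · cases a with
      | true => simp
      | false =>
        cases A with
        | nil => simp at h
        | cons b A => simp [cc_zero]

theorem TT_series (a : Bool) (A : List Bool) (h : (a :: A).getLast? = some true) :
    TT a A [false] 0 = ∑' n, cc (false :: a :: A) n := by
  rw [TT_cons]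
  simp only [II_series (a :: A) (Or.inr h), JJ, mul_one, add_zero, cc, Bool.false_eq_true, if_false]
  have := int_univ (cc (a :: A)) (cc_zero _ _)
  simp only [cc] at this
  rw [← this]
  congr 1; ext p
  rw [← ENNReal.tsum_mul_right]
  refine tsum_congr fun n => ?_
  rw [ENNReal.ofReal_mul (pow_nonneg (Real.sigmoid_nonneg p) _)]
  simp only [om, Bool.false_eq_true, if_false]
  ring

/-- iteration -/
theorem JI_add {f g : ℝ → ENNReal} (hf : Measurable f) : JI (fun L => f L + g L) = fun L => JI f L + JI g L := by
  ext L
  exact lintegral_add_left hf _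

theorem JIn_meas {f : ℝ → ENNReal} (hf : Measurable f) (s : ℕ) : Measurable (JI^[s] f) := by
  induction s with
  | zero => exact hf
  | succ s ih => rw [Function.iterate_succ_apply']; exact JI_meas _

theorem JIn_add {f g : ℝ → ENNReal} (hf : Measurable f) (s : ℕ) :
    JI^[s] (fun L => f L + g L) = fun L => (JI^[s] f) L + (JI^[s] g) L := by
  induction s with
  | zero => rfl
  | succ s ih => 
    simp only [Function.iterate_succ_apply']
    rw [ih, JI_add (JIn_meas hf s)]

theorem JIn_rep {f : ℝ → ENNReal} {α β : ℕ → ℝ} {C : ℝ} (hf : Measurable f) (h : RepW f α β C) (s : ℕ) :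
    ∃ C', RepW (JI^[s] f) (fun n => α n / n ^ s + s * (β n / n ^ (s+1))) (fun n => β n / n ^ s) C' := by
  induction s with
  | zero => exact ⟨C, by simpa using h⟩
  | succ s ih =>
    obtain ⟨C', h'⟩ := ih
    refine ⟨2 * C', ?_⟩
    have := h'.int (JIn_meas hf s)
    rw [← Function.iterate_succ_apply' JI s f] at this
    convert this using 1
    · ext n; push_cast
      rcases eq_or_ne n 0 with rfl | hn
      · simp
      · have : (n : ℝ) ≠ 0 := by exact_mod_cast hn
        field_simp
        ring
    · ext n
      rw [div_div, ← pow_succ]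

theorem rep_TT {a A B} (hA : (a :: A).getLast? = some true) (hB : B.getLast? = some false) :
    RepE (TT a A B) := rep_all _ a A B le_rfl hA hB

theorem JIn_fin {a A B} (hA : (a :: A).getLast? = some true) (hB : B.getLast? = some false) (s : ℕ) :
    (JI^[s] (TT a A B)) 0 ≠ ⊤ := by
  obtain ⟨α, β, C, h⟩ := rep_TT hA hB
  obtain ⟨C', h'⟩ := JIn_rep (TT_meas _ _ _) h s
  exact (h'.2.2 0 le_rfl).1

theorem JIn_step {a A B} (hA : (a :: A).getLast? = some true) (hB : B.getLast? = some false) (s : ℕ) :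
    ((JI^[s+1] (TT a A B)) 0).toReal = ((JI^[s] (TT a A (false :: B))) 0).toReal +
      ((JI^[s] (TT a A (true :: B))) 0).toReal := by
  have h : ∀ b : Bool, (b :: B).getLast? = some false := by
    intro b
    cases B with
    | nil => simp at hB
    | cons c B => rwa [List.getLast?_cons_cons]
  rw [Function.iterate_succ_apply, ← show (fun L => TT a A (false :: B) L + TT a A (true :: B) L) = _ from
    funext fun L => TT_right a A B L, JIn_add (TT_meas _ _ _)]
  exact ENNReal.toReal_add (JIn_fin hA (h _) s) (JIn_fin hA (h _) s)

theorem final_series {a A B} (hA : (a :: A).getLast? = some true) (hB : B.getLast? = some false) :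
    ∃ α β : ℕ → ℝ, ∀ s : ℕ, ∃ L1 L2, HasSum (fun n : ℕ => α n / ((n : ℝ) + 1) ^ s) L1 ∧
      HasSum (fun n : ℕ => β n / ((n : ℝ) + 1) ^ s) L2 ∧
      ((JI^[s] (TT a A B)) 0).toReal = L1 + s * L2 := by
  obtain ⟨α, β, C, h⟩ := rep_TT hA hB
  have hC := h.C_nonneg
  have s1 : ∀ s : ℕ, Summable (fun n : ℕ => α n / (n : ℝ) ^ s) := by
    intro s
    refine Summable.of_norm_bounded (summ32.mul_left C) fun n => ?_
    rw [Real.norm_eq_abs, abs_div, mul_one_div]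
    refine le_trans ?_ (h.1 n)
    rcases eq_or_ne n 0 with rfl | hn
    · have := h.1 0
      simp at this
      simp [this]
    · refine div_le_self (abs_nonneg _) ?_
      rw [abs_of_nonneg (by positivity)]
      exact one_le_pow₀ (by exact_mod_cast Nat.one_le_iff_ne_zero.2 hn)
  have s2 : ∀ s : ℕ, Summable (fun n : ℕ => β n / (n : ℝ) ^ (s+1)) := by
    intro s
    refine Summable.of_norm_bounded (summ32.mul_left C) fun n => ?_
    rw [Real.norm_eq_abs, abs_div, mul_one_div]
    rcases eq_or_ne n 0 with rfl | hn
    · simp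
    · have hn1 : (1:ℝ) ≤ n := by exact_mod_cast Nat.one_le_iff_ne_zero.2 hn
      rw [abs_of_nonneg (by positivity : (0:ℝ) ≤ (n:ℝ) ^ (s+1)), mul_comm (n : ℝ), ← div_div]
      refine div_le_div₀ (by positivity) (h.2.1 n) (by positivity) ?_
      exact le_self_pow₀ hn1 (by omega)
  have z1 : α 0 = 0 := by simpa using h.1 0
  refine ⟨fun n => α (n+1), fun n => β (n+1) / ((n:ℝ)+1), fun s => ⟨∑' n : ℕ, α n / (n : ℝ) ^ s,
    ∑' n : ℕ, β n / (n : ℝ) ^ (s+1), ?_, ?_, ?_⟩⟩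
  · have := (hasSum_nat_add_iff' 1).2 (s1 s).hasSum
    simpa [z1] using this
  · have := (hasSum_nat_add_iff' 1).2 (s2 s).hasSum
    simp only [Finset.sum_range_one, Nat.cast_zero] at this
    rw [zero_pow (by omega), div_zero, sub_zero] at this
    have e : (fun n : ℕ => β (n+1) / ((n:ℝ)+1) / ((n:ℝ)+1) ^ s) =
        fun n : ℕ => β (n+1) / (((n+1 : ℕ) : ℝ)) ^ (s+1) := by
      funext n
      push_cast
      rw [div_div, ← pow_succ']
    rw [e]
    exact this
  · obtain ⟨C', h'⟩ := JIn_rep (TT_meas _ _ _) h s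
    have := (h'.2.2 0 le_rfl).2
    have e := (s1 s).hasSum.add ((s2 s).hasSum.mul_left (s:ℝ))
    refine this.unique ?_
    convert e using 2 with n
    simp [tm]


noncomputable def EE (r : ℕ) (k : Fin (r + 1) → ℕ) (m : ℕ) : ENNReal :=
  open Classical in ∑' n : Fin (r + 1) → ℕ, if StrictMono n ∧ n (Fin.last r) = m then
    ∏ i, ENNReal.ofReal (1 / (n i : ℝ) ^ (k i)) else 0

noncomputable def mon (w : List Bool) : H := (w.map (FreeAlgebra.ι ℚ)).prod

theorem mon_append (w w' : List Bool) : mon (w ++ w') = mon w * mon w' := by simp [mon]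

theorem strictMono_snoc' {r : ℕ} (n : Fin (r + 1) → ℕ) (m : ℕ) :
    StrictMono (Fin.snoc n m : Fin (r + 2) → ℕ) ↔ StrictMono n ∧ n (Fin.last r) < m := by
  constructor
  · intro h
    constructor
    · intro i j hij
      have := h (Fin.castSucc_lt_castSucc_iff.2 hij)
      simpa using this
    · have := h (Fin.castSucc_lt_last (Fin.last r))
      simpa using this
  · rintro ⟨h, h'⟩ i j hij
    induction j using Fin.lastCases with
    | last =>
      induction i using Fin.lastCases with
      | last => exact absurd hij (lt_irrefl _)
      | cast i =>
        simp only [Fin.snoc_castSucc, Fin.snoc_last]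
        exact (h.monotone (Fin.le_last i)).trans_lt h'
    | cast j =>
      induction i using Fin.lastCases with
      | last => exact absurd hij (not_lt.2 (Fin.le_last _))
      | cast i =>
        simp only [Fin.snoc_castSucc]
        exact h (Fin.castSucc_lt_castSucc_iff.1 hij)

theorem EE_update (r : ℕ) (k : Fin (r + 1) → ℕ) (m : ℕ) :
    EE r (Function.update k (Fin.last r) (k (Fin.last r) + 1)) m =
      ENNReal.ofReal (1 / (m : ℝ)) * EE r k m := by
  classical
  unfold EE
  rw [← ENNReal.tsum_mul_left]
  refine tsum_congr fun n => ?_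
  split_ifs with h
  · rw [Fin.prod_univ_castSucc, Fin.prod_univ_castSucc]
    simp only [Function.update_self, h.2]
    rw [pow_succ', ← one_div_mul_one_div, ENNReal.ofReal_mul (by positivity)]
    have : ∀ i : Fin r, Function.update k (Fin.last r) (k (Fin.last r) + 1) i.castSucc = k i.castSucc :=
      fun i => Function.update_of_ne (Fin.castSucc_lt_last i).ne _ _
    simp only [this]
    ring
  · simp

theorem tsum_snoc (r : ℕ) (F : (Fin (r + 2) → ℕ) → ENNReal) :
    ∑' n, F n = ∑' m : ℕ, ∑' n : Fin (r + 1) → ℕ, F (Fin.snoc n m) := by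
  rw [← ENNReal.tsum_prod (f := fun (m : ℕ) (n : Fin (r + 1) → ℕ) => F (Fin.snoc n m))]
  exact ((Fin.snocEquiv (fun _ : Fin (r + 2) => ℕ)).tsum_eq F).symm

theorem EE_snoc (r : ℕ) (k : Fin (r + 1) → ℕ) (m : ℕ) :
    EE (r + 1) (Fin.snoc k 1) m =
      ENNReal.ofReal (1 / (m : ℝ)) * ∑ j ∈ Finset.range m, EE r k j := by
  classical
  unfold EE
  rw [tsum_snoc, tsum_eq_single m,
    ← Summable.tsum_finsetSum (fun _ _ => ENNReal.summable), ← ENNReal.tsum_mul_left]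
  · refine tsum_congr fun n => ?_
    simp only [strictMono_snoc', Fin.snoc_last, and_true]
    rw [Fin.prod_univ_castSucc]
    simp only [Fin.snoc_castSucc, Fin.snoc_last, pow_one]
    by_cases h1 : StrictMono n
    · by_cases h2 : n (Fin.last r) < m
      · simp [h1, h2, mul_comm]
      · simp [h1, h2]
    · simp [h1]
  · intro m' hm'
    refine ENNReal.tsum_eq_zero.2 fun n => ?_
    rw [if_neg]
    rintro ⟨_, h⟩
    exact hm' (by simpa using h)

theorem EE_base (m : ℕ) : EE 0 (fun _ => 1) m = ENNReal.ofReal (1 / (m : ℝ)) := by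
  classical
  unfold EE
  rw [tsum_eq_single (fun _ => m)]
  · rw [if_pos ⟨fun i j h => absurd h (by omega), rfl⟩]; simp
  · intro n hn
    rw [if_neg]
    rintro ⟨_, h⟩
    exact hn (funext fun i => by rw [← h]; congr 1; ext; simp)

theorem link (A : List Bool) (h : A.getLast? = some true) :
    ∃ r, ∃ k : Fin (r + 1) → ℕ, (∀ i, 1 ≤ k i) ∧ (A.head? = some false → 2 ≤ k (Fin.last r)) ∧
      mon A.reverse = (List.ofFn fun i => Hy * Hx ^ (k i - 1)).prod ∧ ∀ m, cc A m = EE r k m := by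
  induction A with
  | nil => simp at h
  | cons a A ih =>
    cases A with
    | nil =>
      have : a = true := by simpa using h
      subst this
      refine ⟨0, fun _ => 1, fun _ => le_rfl, by simp, by simp [mon, Hy], fun m => ?_⟩
      rw [EE_base]
      rcases eq_or_ne m 0 with rfl | hm
      · simp [cc]
      · obtain ⟨m, rfl⟩ := Nat.exists_eq_succ_of_ne_zero hm
        simp [cc]
    | cons b A =>
      rw [List.getLast?_cons_cons] at h
      obtain ⟨r, k, h1, h2, h3, h4⟩ := ih h
      rw [List.reverse_cons, mon_append, h3]
      cases a with
      | false =>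
        refine ⟨r, Function.update k (Fin.last r) (k (Fin.last r) + 1), fun i => ?_, fun _ => ?_, ?_,
          fun m => ?_⟩
        · rcases eq_or_ne i (Fin.last r) with rfl | hi
          · simp
          · simp [hi, h1]
        · have := h1 (Fin.last r)
          simp; omega
        · rw [List.ofFn_succ_last, List.ofFn_succ_last]
          have : k (Fin.last r) = k (Fin.last r) - 1 + 1 := by have := h1 (Fin.last r); omega
          simp only [Function.update_self, List.prod_append, List.prod_singleton]
          rw [Nat.add_sub_cancel]
          conv_rhs => rw [this, pow_succ]
          simp [mon, Hx, mul_assoc]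
        · rw [EE_update, ← h4, cc]; simp
      | true =>
        refine ⟨r + 1, Fin.snoc k 1, fun i => ?_, by simp, ?_, fun m => ?_⟩
        · induction i using Fin.lastCases with
          | last => simp
          | cast i => simpa using h1 i
        · rw [List.ofFn_succ_last (n := r + 1)]
          simp [mon, Hy, mul_assoc]
        · rw [EE_snoc, cc]; simp only [if_true, h4]

theorem MZV_eq (r : ℕ) (k : Fin (r + 1) → ℕ) (hk : ∀ i, 1 ≤ k i) :
    MZV (r + 1) k = (∑' m, EE r k m).toReal := by
  classical
  have e : ∑' m, EE r k m = ∑' n : Fin (r + 1) → ℕ, if StrictMono n then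
      ∏ i, ENNReal.ofReal (1 / (n i : ℝ) ^ (k i)) else 0 := by
    unfold EE
    rw [ENNReal.tsum_comm]
    refine tsum_congr fun n => ?_
    rw [tsum_eq_single (n (Fin.last r))]
    · simp
    · intro m hm
      rw [if_neg]
      rintro ⟨_, h⟩
      exact hm h.symm
  rw [e, ENNReal.tsum_toReal_eq]
  · rw [MZV]
    refine (tsum_subtype {n : Fin (r + 1) → ℕ | (∀ i, 0 < n i) ∧ StrictMono n}
      (fun n => ∏ i, (1 : ℝ) / (n i : ℝ) ^ (k i))).trans ?_
    refine tsum_congr fun n => ?_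
    by_cases h : StrictMono n
    · have hp : (∏ i, ENNReal.ofReal (1 / (n i : ℝ) ^ (k i))).toReal = ∏ i, (1 : ℝ) / (n i : ℝ) ^ (k i) := by
        rw [ENNReal.toReal_prod]
        exact Finset.prod_congr rfl fun i _ => ENNReal.toReal_ofReal (by positivity)
      rw [if_pos h, hp]
      by_cases h' : ∀ i, 0 < n i
      · exact indicator_of_mem (s := {n : Fin (r + 1) → ℕ | (∀ i, 0 < n i) ∧ StrictMono n}) ⟨h', h⟩ _
      · refine (indicator_of_notMem (s := {n : Fin (r + 1) → ℕ | (∀ i, 0 < n i) ∧ StrictMono n})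
          (fun hh => h' hh.1) _).trans ?_
        push Not at h'
        obtain ⟨i, hi⟩ := h'
        symm
        refine Finset.prod_eq_zero (Finset.mem_univ i) ?_
        have : n i = 0 := by omega
        have h1 := hk i
        rw [this, Nat.cast_zero, zero_pow (by omega), div_zero]
    · rw [if_neg h]
      refine (indicator_of_notMem (s := {n : Fin (r + 1) → ℕ | (∀ i, 0 < n i) ∧ StrictMono n})
          (fun hh => h hh.2) _).trans ?_
      simp
  · intro n
    split_ifs
    · exact ENNReal.prod_ne_top fun i _ => ENNReal.ofReal_ne_top
    · simp

theorem Z_base (Z : H →ₗ[ℚ] ℝ) (hZ : IsZetaMap Z) (a : Bool) (A : List Bool)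
    (h : (a :: A).getLast? = some true) :
    Z (mon ((a :: A).reverse ++ [false])) = (TT a A [false] 0).toReal := by
  have h' : (false :: a :: A).getLast? = some true := by rwa [List.getLast?_cons_cons]
  obtain ⟨r, k, h1, h2, h3, h4⟩ := link _ h'
  rw [← List.reverse_cons, h3, hZ r k h1 (h2 rfl), MZV_eq r k h1, TT_series a A h]
  simp only [h4]

theorem Z_word (Z : H →ₗ[ℚ] ℝ) (hZ : IsZetaMap Z) (B : List Bool) : ∀ (a : Bool) (A : List Bool),
    (a :: A).getLast? = some true → B.getLast? = some false →
    Z (mon ((a :: A).reverse ++ B)) = (TT a A B 0).toReal := by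
  induction B with
  | nil => intro a A _ h; simp at h
  | cons b B ih =>
    intro a A hA hB
    cases B with
    | nil =>
      have : b = false := by simpa using hB
      subst this
      exact Z_base Z hZ a A hA
    | cons c B =>
      rw [List.getLast?_cons_cons] at hB
      have := ih b (a :: A) (by rwa [List.getLast?_cons_cons]) hB
      rw [TT_move] at this
      rw [← this]
      simp

theorem Z_pow (Z : H →ₗ[ℚ] ℝ) (hZ : IsZetaMap Z) (a : Bool) (A : List Bool)
    (hA : (a :: A).getLast? = some true) (s : ℕ) : ∀ B : List Bool, B.getLast? = some false →
    Z (mon (a :: A).reverse * (Hx + Hy) ^ s * mon B) = ((JI^[s] (TT a A B)) 0).toReal := by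
  induction s with
  | zero =>
    intro B hB
    rw [pow_zero, mul_one, ← mon_append, Z_word Z hZ B a A hA hB]; rfl
  | succ s ih =>
    intro B hB
    have h : ∀ b : Bool, (b :: B).getLast? = some false := by
      intro b
      cases B with
      | nil => simp at hB
      | cons c B => rwa [List.getLast?_cons_cons]
    rw [JIn_step hA hB, ← ih _ (h _), ← ih _ (h _), ← map_add]
    congr 1
    rw [pow_succ, ← mul_add]
    simp only [mon, List.map_cons, List.prod_cons, Hx, Hy]
    noncomm_ring

theorem mon_span (w : H) : w ∈ Submodule.span ℚ (Set.range mon) := by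
  induction w using FreeAlgebra.induction with
  | grade0 r =>
    rw [Algebra.algebraMap_eq_smul_one]
    exact Submodule.smul_mem _ _ (Submodule.subset_span ⟨[], by simp [mon]⟩)
  | grade1 b => exact Submodule.subset_span ⟨[b], by simp [mon]⟩
  | mul u v hu hv =>
    have := Submodule.mul_mem_mul hu hv
    rw [Submodule.span_mul_span] at this
    refine Submodule.span_mono ?_ this
    rintro _ ⟨_, ⟨w, rfl⟩, _, ⟨w', rfl⟩, rfl⟩
    exact ⟨w ++ w', mon_append _ _⟩
  | add u v hu hv => exact Submodule.add_mem _ hu hv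

def PP (F : ℕ → ℝ) : Prop := ∃ a b : ℕ → ℝ,
      ∀ s : ℕ, ∃ L1 L2 : ℝ, DSConv a s L1 ∧ DSConv b s L2 ∧ F s = L1 + (s : ℝ) * L2

theorem PP.add {F G : ℕ → ℝ} (hF : PP F) (hG : PP G) : PP (fun s => F s + G s) := by
  obtain ⟨a, b, h⟩ := hF
  obtain ⟨a', b', h'⟩ := hG
  refine ⟨fun n => a n + a' n, fun n => b n + b' n, fun s => ?_⟩
  obtain ⟨L1, L2, h1, h2, h3⟩ := h s
  obtain ⟨L1', L2', h1', h2', h3'⟩ := h' s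
  refine ⟨L1 + L1', L2 + L2', ?_, ?_, ?_⟩
  · refine (Tendsto.add h1 h1').congr fun N => ?_
    rw [← Finset.sum_add_distrib]
    simp only [add_div]
  · refine (Tendsto.add h2 h2').congr fun N => ?_
    rw [← Finset.sum_add_distrib]
    simp only [add_div]
  · simp only [h3, h3']; ring

theorem PP.smul {F : ℕ → ℝ} (hF : PP F) (c : ℝ) : PP (fun s => c * F s) := by
  obtain ⟨a, b, h⟩ := hF
  refine ⟨fun n => c * a n, fun n => c * b n, fun s => ?_⟩
  obtain ⟨L1, L2, h1, h2, h3⟩ := h s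
  refine ⟨c * L1, c * L2, ?_, ?_, ?_⟩
  · refine (Tendsto.const_mul c h1).congr fun N => ?_
    rw [Finset.mul_sum]
    simp only [mul_div_assoc]
  · refine (Tendsto.const_mul c h2).congr fun N => ?_
    rw [Finset.mul_sum]
    simp only [mul_div_assoc]
  · simp only [h3]; ring

theorem PP.of_mem {M : Submodule ℚ H} {S : Set H} (hM : M = Submodule.span ℚ S) (T : ℕ → H →ₗ[ℚ] ℝ)
    (h : ∀ w ∈ S, PP (fun s => T s w)) (w : H) (hw : w ∈ M) : PP (fun s => T s w) := by
  subst hM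
  induction hw using Submodule.span_induction with
  | mem x hx => exact h x hx
  | zero =>
    refine ⟨0, 0, fun s => ⟨0, 0, ?_, ?_, by simp⟩⟩ <;> simp [DSConv]
  | add x y _ _ hx hy => simpa only [map_add] using hx.add hy
  | smul c x _ hx =>
    have := hx.smul (c : ℝ)
    simpa only [map_smul, Rat.smul_def] using this

theorem PP_word (Z : H →ₗ[ℚ] ℝ) (hZ : IsZetaMap Z) (w w' : List Bool) :
    PP (fun s => Z (Hy * mon w * (Hx + Hy) ^ s * (mon w' * Hx))) := by
  obtain ⟨a, A, hA⟩ : ∃ a A, (true :: w).reverse = a :: A :=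
    List.exists_cons_of_ne_nil (by simp)
  have hA' : (a :: A).getLast? = some true := by rw [← hA]; simp
  have hB' : (w' ++ [false]).getLast? = some false := by simp
  have e1 : Hy * mon w = mon (a :: A).reverse := by rw [← hA, List.reverse_reverse]; simp [mon, Hy]
  have e2 : mon w' * Hx = mon (w' ++ [false]) := by simp [mon, Hx]
  obtain ⟨α, β, h⟩ := final_series hA' hB'
  refine ⟨α, β, fun s => ?_⟩
  obtain ⟨L1, L2, h1, h2, h3⟩ := h s
  refine ⟨L1, L2, h1.tendsto_sum_nat, h2.tendsto_sum_nat, ?_⟩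
  rw [← h3, e1, e2]
  exact Z_pow Z hZ a A hA' s _ hB'

theorem PP_all (Z : H →ₗ[ℚ] ℝ) (hZ : IsZetaMap Z) (w w' : H) :
    PP (fun s => Z (Hy * w * (Hx + Hy) ^ s * (w' * Hx))) := by
  refine PP.of_mem rfl (fun s => Z ∘ₗ LinearMap.mulRight ℚ ((Hx + Hy) ^ s * (w' * Hx)) ∘ₗ
    LinearMap.mulLeft ℚ Hy) ?_ w (mon_span w) |> fun h => by simpa [mul_assoc] using h
  rintro _ ⟨v, rfl⟩
  refine PP.of_mem rfl (fun s => Z ∘ₗ LinearMap.mulLeft ℚ (Hy * mon v * (Hx + Hy) ^ s) ∘ₗ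
    LinearMap.mulRight ℚ Hx) ?_ w' (mon_span w') |> fun h => by simpa [mul_assoc] using h
  rintro _ ⟨v', rfl⟩
  simpa [mul_assoc] using PP_word Z hZ v v'



end Helpers

/-- For every `A ∈ yℌ` and `B ∈ ℌx`, there exist real sequences
`(a_n)_{n≥1}` and `(b_n)_{n≥1}` such that the Dirichlet series
`L₁(s) = ∑_{n≥1} a_n/n^s` and `L₂(s) = ∑_{n≥1} b_n/n^s` converge for all integers
`s ≥ 0`, and `Z(A(x+y)^s B) = L₁(s) + s·L₂(s)` holds for all integers `s ≥ 0`. -/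
theorem statement10 (Z : H →ₗ[ℚ] ℝ) (hZ : IsZetaMap Z)
    (A B : H) (hA : ∃ w, A = Hy * w) (hB : ∃ w, B = w * Hx) :
    ∃ a b : ℕ → ℝ,
      ∀ s : ℕ, ∃ L1 L2 : ℝ, DSConv a s L1 ∧ DSConv b s L2 ∧
        Z (A * (Hx + Hy) ^ s * B) = L1 + (s : ℝ) * L2 := by
  obtain ⟨w, rfl⟩ := hA
  obtain ⟨w', rfl⟩ := hB
  exact PP_all Z hZ w w'

end
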